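/- Fix two finite-horizon MDPs M=(S,A,P,r,H) and M'=(S,A,P',r,H) with the same states, actions, rewards, horizon and initial state s0, possibly time-dependent dynamics, and let Δ = {(s,a,h) : P_h(·|s,a) ≠ P'_h(·|s,a)}. Suppose the projection D = {(s,a) : (s,a,h) ∈ Δ for some h} has at most K elements. Then for any policy π and any ρ > 0, if V^{M',π}_0(s0) − V^{M,*}_0(s0) > ρ, there exists a pair (s,a) ∈ D such that P^{M}((s,a) ∈ τ_π) > ρ/(KH). -/

import Mathlib

open Finset

namespace MDPform

variable {S A : Type}

/-- Probability that a deterministic nonstationary policy `π`, run from `s0` for `H` steps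
in an MDP with (time-dependent) dynamics `P`, produces the state trajectory `τ`. -/
def trajProb [Fintype S] [DecidableEq S] (P : ℕ → S → A → S → ℝ) (π : ℕ → S → A)
    (s0 : S) (H : ℕ) (τ : Fin (H + 1) → S) : ℝ :=
  (if τ 0 = s0 then (1 : ℝ) else 0) *
    ∏ h : Fin H, P h (τ h.castSucc) (π h (τ h.castSucc)) (τ h.succ)

/-- Sum of rewards along a trajectory. -/
def ret (r : S → A → ℝ) (π : ℕ → S → A) (H : ℕ) (τ : Fin (H + 1) → S) : ℝ :=
  ∑ h : Fin H, r (τ h.castSucc) (π h (τ h.castSucc))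

/-- Value `V^{M,π}_0(s0)` of policy `π`. -/
def value [Fintype S] [DecidableEq S] (P : ℕ → S → A → S → ℝ) (r : S → A → ℝ)
    (π : ℕ → S → A) (s0 : S) (H : ℕ) : ℝ :=
  ∑ τ : Fin (H + 1) → S, trajProb P π s0 H τ * ret r π H τ

/-- Optimal value `V^{M,*}_0(s0)`. -/
noncomputable def optValue [Fintype S] [DecidableEq S] (P : ℕ → S → A → S → ℝ)
    (r : S → A → ℝ) (s0 : S) (H : ℕ) : ℝ :=
  ⨆ π : ℕ → S → A, value P r π s0 H

/-- Probability of a set of trajectories. -/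
noncomputable def probEvent [Fintype S] [DecidableEq S] (P : ℕ → S → A → S → ℝ)
    (π : ℕ → S → A) (s0 : S) (H : ℕ) (E : Set (Fin (H + 1) → S)) : ℝ :=
  ∑ τ : Fin (H + 1) → S, E.indicator (trajProb P π s0 H) τ

/-- Probability that the trajectory of `π` visits the state-action pair `(s,a)`. -/
noncomputable def visitProb [Fintype S] [DecidableEq S] (P : ℕ → S → A → S → ℝ)
    (π : ℕ → S → A) (s0 : S) (H : ℕ) (s : S) (a : A) : ℝ :=
  probEvent P π s0 H {τ | ∃ h : Fin H, τ h.castSucc = s ∧ π h (τ h.castSucc) = a}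

/-- A transition kernel is stochastic: nonnegative entries, rows summing to one. -/
def IsStochastic [Fintype S] (P : S → A → S → ℝ) : Prop :=
  (∀ s a s', 0 ≤ P s a s') ∧ ∀ s a, ∑ s' : S, P s a s' = 1

/-- The dynamics of `M∖(s,a)`: the terminal state `⊖` is modelled by `none`, is absorbing,
and taking action `a` at state `s` transitions deterministically to it. -/
def removeSA [DecidableEq S] [DecidableEq A] (P : S → A → S → ℝ) (s : S) (a : A) :
    Option S → A → Option S → ℝ
  | none, _, y => if y = none then 1 else 0
  | some x, u, y =>
      if x = s ∧ u = a then (if y = none then 1 else 0)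
      else Option.elim y 0 (fun y' => P x u y')

/-- Rewards lifted to `M∖(s,a)`: the terminal state carries zero reward. -/
def liftReward (r : S → A → ℝ) : Option S → A → ℝ
  | none, _ => 0
  | some x, u => r x u

/-- Backward-recursive value `V^{M,π}_h(s)` for time-dependent dynamics. -/
def Vpol [Fintype S] (P : ℕ → S → A → S → ℝ) (r : S → A → ℝ) (π : ℕ → S → A)
    (H : ℕ) (h : ℕ) (s : S) : ℝ :=
  if hlt : h < H then
    r s (π h s) + ∑ s' : S, P h s (π h s) s' * Vpol P r π H (h + 1) s'
  else 0
termination_by H - h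

theorem ret_nonneg {r : S → A → ℝ} (hr : ∀ s a, r s a ∈ Set.Icc (0 : ℝ) 1)
    (π : ℕ → S → A) (H : ℕ) (τ : Fin (H + 1) → S) : 0 ≤ ret r π H τ :=
  sum_nonneg fun _ _ => (hr _ _).1

theorem ret_le {r : S → A → ℝ} (hr : ∀ s a, r s a ∈ Set.Icc (0 : ℝ) 1)
    (π : ℕ → S → A) (H : ℕ) (τ : Fin (H + 1) → S) : ret r π H τ ≤ H := by
  refine (sum_le_sum fun _ _ => (hr _ _).2).trans ?_
  simp

section Trajectories

variable [Fintype S] [DecidableEq S]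

theorem trajProb_nonneg {P : ℕ → S → A → S → ℝ} (hP : ∀ h, IsStochastic (P h))
    (π : ℕ → S → A) (s0 : S) (H : ℕ) (τ : Fin (H + 1) → S) : 0 ≤ trajProb P π s0 H τ := by
  unfold trajProb
  refine mul_nonneg (by split_ifs <;> norm_num) (prod_nonneg fun h _ => (hP h).1 _ _ _)

theorem trajProb_snoc (P : ℕ → S → A → S → ℝ) (π : ℕ → S → A) (s0 : S) (H : ℕ)
    (τ : Fin (H + 1) → S) (x : S) :
    trajProb P π s0 (H + 1) (Fin.snoc (α := fun _ => S) τ x) =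
      trajProb P π s0 H τ * P H (τ (Fin.last H)) (π H (τ (Fin.last H))) x := by
  have h0 : Fin.snoc (α := fun _ => S) τ x 0 = τ 0 :=
    Fin.snoc_castSucc (α := fun _ => S) x τ 0
  unfold trajProb
  rw [Fin.prod_univ_castSucc, h0]
  simp only [Fin.snoc_castSucc, Fin.succ_last, Fin.snoc_last, Fin.succ_castSucc,
    Fin.val_castSucc, Fin.val_last, mul_assoc]

theorem sum_trajProb {P : ℕ → S → A → S → ℝ} (hP : ∀ h, IsStochastic (P h))
    (π : ℕ → S → A) (s0 : S) (H : ℕ) : ∑ τ, trajProb P π s0 H τ = 1 := by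
  induction H with
  | zero =>
    rw [← (Equiv.funUnique (Fin 1) S).symm.sum_comp]
    simp [trajProb]
  | succ H ih =>
    rw [← (Fin.snocEquiv (fun _ : Fin (H + 2) => S)).sum_comp, Fintype.sum_prod_type_right]
    simp only [Fin.snocEquiv, Equiv.coe_fn_mk, trajProb_snoc, ← mul_sum, (hP H).2, mul_one, ih]

theorem trajProb_congr {P P' : ℕ → S → A → S → ℝ} {π : ℕ → S → A} {s0 : S} {H : ℕ}
    {τ : Fin (H + 1) → S}
    (h : ∀ k : Fin H, P k (τ k.castSucc) (π k (τ k.castSucc)) =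
      P' k (τ k.castSucc) (π k (τ k.castSucc))) :
    trajProb P π s0 H τ = trajProb P' π s0 H τ := by
  simp only [trajProb, h]

theorem value_le_optValue {P : ℕ → S → A → S → ℝ} (hP : ∀ h, IsStochastic (P h))
    {r : S → A → ℝ} (hr : ∀ s a, r s a ∈ Set.Icc (0 : ℝ) 1) (π : ℕ → S → A) (s0 : S) (H : ℕ) :
    value P r π s0 H ≤ optValue P r s0 H := by
  refine le_ciSup (f := fun π : ℕ → S → A => value P r π s0 H) ⟨H, ?_⟩ π
  rintro _ ⟨π, rfl⟩
  calc value P r π s0 H ≤ ∑ τ, trajProb P π s0 H τ * H :=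
        sum_le_sum fun τ _ =>
          mul_le_mul_of_nonneg_left (ret_le hr π H τ) (trajProb_nonneg hP π s0 H τ)
    _ = H := by rw [← sum_mul, sum_trajProb hP, one_mul]

/-- Two dynamics which agree on all trajectories outside `E` have values that differ by at most
`H` times the probability of `E`. -/
theorem value_sub_value_le {P P' : ℕ → S → A → S → ℝ} (hP : ∀ h, IsStochastic (P h))
    (hP' : ∀ h, IsStochastic (P' h)) {r : S → A → ℝ} (hr : ∀ s a, r s a ∈ Set.Icc (0 : ℝ) 1)
    (π : ℕ → S → A) (s0 : S) (H : ℕ) (E : Set (Fin (H + 1) → S))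
    (hE : ∀ τ ∉ E, trajProb P π s0 H τ = trajProb P' π s0 H τ) :
    value P' r π s0 H - value P r π s0 H ≤ H * probEvent P π s0 H E := by
  have hterm : ∀ τ, trajProb P' π s0 H τ * ret r π H τ - trajProb P π s0 H τ * ret r π H τ ≤
      H * (E.indicator (trajProb P π s0 H) τ +
        (trajProb P' π s0 H τ - trajProb P π s0 H τ)) := by
    intro τ
    by_cases hτ : τ ∈ E
    · rw [Set.indicator_of_mem hτ]
      have h1 := mul_le_mul_of_nonneg_left (ret_le hr π H τ) (trajProb_nonneg hP' π s0 H τ)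
      have h2 := mul_nonneg (trajProb_nonneg hP π s0 H τ) (ret_nonneg hr π H τ)
      linarith
    · simp [Set.indicator_of_notMem hτ, hE τ hτ]
  calc value P' r π s0 H - value P r π s0 H
      ≤ ∑ τ, H * (E.indicator (trajProb P π s0 H) τ +
        (trajProb P' π s0 H τ - trajProb P π s0 H τ)) := by
        rw [value, value, ← sum_sub_distrib]
        exact sum_le_sum fun τ _ => hterm τ
    _ = H * probEvent P π s0 H E := by
        rw [← mul_sum, sum_add_distrib, sum_sub_distrib, sum_trajProb hP, sum_trajProb hP',
          sub_self, add_zero, probEvent]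

theorem probEvent_visit_le_sum {P : ℕ → S → A → S → ℝ} (hP : ∀ h, IsStochastic (P h))
    (π : ℕ → S → A) (s0 : S) (H : ℕ) (D : Finset (S × A)) :
    probEvent P π s0 H {τ | ∃ h : Fin H, (τ h.castSucc, π h (τ h.castSucc)) ∈ D} ≤
      ∑ p ∈ D, visitProb P π s0 H p.1 p.2 := by
  unfold visitProb probEvent
  rw [sum_comm]
  refine sum_le_sum fun τ _ => ?_
  have hnn : ∀ p ∈ D, 0 ≤ ({τ | ∃ h : Fin H, τ h.castSucc = p.1 ∧
      π h (τ h.castSucc) = p.2} : Set (Fin (H + 1) → S)).indicator (trajProb P π s0 H) τ :=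
    fun _ _ => Set.indicator_nonneg (fun τ _ => trajProb_nonneg hP π s0 H τ) τ
  by_cases hτ : ∃ h : Fin H, (τ h.castSucc, π h (τ h.castSucc)) ∈ D
  · obtain ⟨h, hh⟩ := hτ
    refine le_trans (le_of_eq ?_) (single_le_sum hnn hh)
    rw [Set.indicator_of_mem (by exact ⟨h, hh⟩), Set.indicator_of_mem (by exact ⟨h, rfl, rfl⟩)]
  · rw [Set.indicator_of_notMem (by exact hτ)]
    exact sum_nonneg hnn

end Trajectories

/-- If the projection `D` of the disagreement set onto state-action pairs
has at most `K` elements, and a policy's value in `M'` exceeds the optimal value of `M` by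
more than `ρ`, then some pair of `D` is visited by `π` in `M` with probability greater than
`ρ/(K·H)`. -/
theorem value_gap_implies_pair_visitation
    {S A : Type} [Fintype S] [DecidableEq S] [Nonempty S]
    [Fintype A] [DecidableEq A] [Nonempty A]
    (P P' : ℕ → S → A → S → ℝ) (hP : ∀ h, IsStochastic (P h)) (hP' : ∀ h, IsStochastic (P' h))
    (r : S → A → ℝ) (hr : ∀ s a, r s a ∈ Set.Icc (0 : ℝ) 1)
    (H : ℕ) (s0 : S) (K : ℕ)
    (hD : {p : S × A | ∃ h < H, P h p.1 p.2 ≠ P' h p.1 p.2}.ncard ≤ K)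
    (π : ℕ → S → A) (ρ : ℝ) (hρ : 0 < ρ)
    (hgap : value P' r π s0 H - optValue P r s0 H > ρ) :
    ∃ p ∈ {p : S × A | ∃ h < H, P h p.1 p.2 ≠ P' h p.1 p.2},
      visitProb P π s0 H p.1 p.2 > ρ / (K * H) := by
  classical
  set D := {p : S × A | ∃ h < H, P h p.1 p.2 ≠ P' h p.1 p.2}
  by_contra! hvisit
  rw [Set.ncard_eq_toFinset_card'] at hD
  have hagree : ∀ τ ∉ {τ : Fin (H + 1) → S |
      ∃ h : Fin H, (τ h.castSucc, π h (τ h.castSucc)) ∈ D.toFinset},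
      trajProb P π s0 H τ = trajProb P' π s0 H τ := by
    intro τ hτ
    refine trajProb_congr fun k => ?_
    by_contra hne
    exact hτ ⟨k, Set.mem_toFinset.2 ⟨k, k.2, hne⟩⟩
  have hdiff := value_sub_value_le hP hP' hr π s0 H _ hagree
  have hopt := value_le_optValue hP hr π s0 H
  have hsum : ∑ p ∈ D.toFinset, visitProb P π s0 H p.1 p.2 ≤ K * (ρ / (K * H)) := by
    calc ∑ p ∈ D.toFinset, visitProb P π s0 H p.1 p.2
        ≤ ∑ _p ∈ D.toFinset, ρ / (K * H) :=
          sum_le_sum fun p hp => hvisit p (Set.mem_toFinset.1 hp)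
      _ ≤ K * (ρ / (K * H)) := by
          rw [sum_const, nsmul_eq_mul]
          gcongr
  have hbound : H * (K * (ρ / (K * H))) ≤ ρ := by
    rw [← mul_assoc, mul_comm (H : ℝ) K]
    rcases eq_or_ne ((K : ℝ) * H) 0 with h | h
    · simpa [h] using hρ.le
    · exact (mul_div_cancel₀ ρ h).le
  have hprob := mul_le_mul_of_nonneg_left
    ((probEvent_visit_le_sum hP π s0 H D.toFinset).trans hsum) (Nat.cast_nonneg (α := ℝ) H)
  linarith

end MDPform
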